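/- Let d ≥ 2 and let F : [0,1]×ℝ^d → ℝ be a bounded measurable function such that F(s,·) = 0 for all s ∈ [0,1/6] and supp F(s,·) ⊆ Q = [−1/2,1/2]^d for all s ∈ [0,1]. Then there exists a constant C = C(d) such that for every t ∈ (1/6, 1] and every x ∈ ℝ^d, the Duhamel integral u(t,x) := ∫₀ᵗ ∫_{ℝ^d} p(t−s, x−y) F(s,y) dy ds satisfies |u(t,x)| ≤ C ‖F‖_{L^∞} ∫_Q p(t − 1/12, x−z) dz, and consequently |u(t,x)| ≤ C ‖F‖_{L^∞} e^{−|x|²/8}. -/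

import Mathlib

open MeasureTheory Real Set
open scoped ENNReal

noncomputable section

/-- `ℝ^d` with the Euclidean structure. -/
abbrev Rd (d : ℕ) := EuclideanSpace ℝ (Fin d)

/-- The closed unit cube `Q = [-1/2, 1/2]^d`. -/
def unitCube (d : ℕ) : Set (Rd d) := {x | ∀ i, |x i| ≤ 1 / 2}

/-- The heat kernel `p(t,x) = (4πt)^{-d/2} exp(-|x|²/(4t))` on `ℝ^d`. -/
noncomputable def heatKernel (d : ℕ) (t : ℝ) (x : Rd d) : ℝ :=
  (4 * π * t) ^ (-(d : ℝ) / 2) * Real.exp (-‖x‖ ^ 2 / (4 * t))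

/-- `∫_Q p(t, x - z) dz`. -/
noncomputable def cubeHeat (d : ℕ) (t : ℝ) (x : Rd d) : ℝ :=
  ∫ z in unitCube d, heatKernel d t (x - z)

/-- The Duhamel integral `u(t,x) = ∫₀ᵗ ∫ p(t-s, x-y) F(s,y) dy ds`. -/
noncomputable def duhamel (d : ℕ) (F : ℝ → Rd d → ℝ) (t : ℝ) (x : Rd d) : ℝ :=
  ∫ s in Ioc (0:ℝ) t, ∫ y, heatKernel d (t - s) (x - y) * F s y

lemma isClosed_unitCube (d : ℕ) : IsClosed (unitCube d) := by
  have : unitCube d = ⋂ i, {x : Rd d | |x i| ≤ 1 / 2} := by ext x; simp [unitCube]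
  rw [this]
  exact isClosed_iInter fun i => isClosed_le (by fun_prop) continuous_const

lemma norm_sq_le_of_forall_abs_le {d : ℕ} {a : ℝ} {x : Rd d} (hx : ∀ i, |x i| ≤ a) :
    ‖x‖ ^ 2 ≤ d * a ^ 2 := by
  rw [EuclideanSpace.norm_sq_eq]
  calc ∑ i, ‖x i‖ ^ 2 ≤ ∑ _i : Fin d, a ^ 2 := by
        gcongr with i
        exact hx i
    _ = d * a ^ 2 := by simp

lemma norm_sq_le_of_mem_unitCube {d : ℕ} {x : Rd d} (hx : x ∈ unitCube d) :
    ‖x‖ ^ 2 ≤ d / 4 := by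
  have := norm_sq_le_of_forall_abs_le hx
  linarith

lemma norm_sub_sq_le_of_mem_unitCube {d : ℕ} {x y : Rd d} (hx : x ∈ unitCube d)
    (hy : y ∈ unitCube d) : ‖x - y‖ ^ 2 ≤ d := by
  have := norm_sq_le_of_forall_abs_le (x := x - y) (a := 1) fun i => by
    have h1 := hx i
    have h2 := hy i
    have h3 := abs_sub (x i) (y i)
    simp only [PiLp.sub_apply]
    linarith
  linarith

lemma volume_unitCube_lt_top (d : ℕ) : volume (unitCube d) < ∞ := by
  have : unitCube d ⊆ Metric.closedBall 0 (√(d / 4)) := fun x hx => by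
    rw [mem_closedBall_zero_iff]
    exact Real.le_sqrt_of_sq_le (norm_sq_le_of_mem_unitCube hx)
  exact (measure_mono this).trans_lt measure_closedBall_lt_top

lemma volume_unitCube_pos (d : ℕ) : 0 < volume (unitCube d) := by
  have : Metric.ball (0 : Rd d) (1 / 2) ⊆ unitCube d := fun x hx i => by
    rw [mem_ball_zero_iff] at hx
    exact (PiLp.norm_apply_le x i).trans hx.le
  exact (Metric.measure_ball_pos _ _ (by norm_num)).trans_le (measure_mono this)

lemma volume_real_unitCube_pos (d : ℕ) : 0 < volume.real (unitCube d) :=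
  ENNReal.toReal_pos (volume_unitCube_pos d).ne' (volume_unitCube_lt_top d).ne

lemma heatKernel_nonneg (d : ℕ) {t : ℝ} (ht : 0 ≤ t) (x : Rd d) : 0 ≤ heatKernel d t x := by
  unfold heatKernel; positivity

lemma heatKernel_zero {d : ℕ} (hd : d ≠ 0) (x : Rd d) : heatKernel d 0 x = 0 := by
  simp [heatKernel, Real.zero_rpow, hd]

lemma continuous_heatKernel (d : ℕ) (t : ℝ) : Continuous (heatKernel d t) := by
  unfold heatKernel; fun_prop

lemma integral_exp_neg_mul_norm_sq (d : ℕ) {b : ℝ} (hb : 0 < b) :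
    ∫ x : Rd d, Real.exp (-b * ‖x‖ ^ 2) = (π / b) ^ ((d : ℝ) / 2) := by
  simpa using GaussianFourier.integral_rexp_neg_mul_sq_norm (V := Rd d) hb

lemma integrable_exp_neg_mul_norm_sq (d : ℕ) {b : ℝ} (hb : 0 < b) :
    Integrable fun x : Rd d => Real.exp (-b * ‖x‖ ^ 2) := by
  apply Integrable.of_integral_ne_zero
  rw [integral_exp_neg_mul_norm_sq d hb]
  positivity

lemma integrable_heatKernel (d : ℕ) {t : ℝ} (ht : 0 < t) : Integrable (heatKernel d t) := by
  have := (integrable_exp_neg_mul_norm_sq d (b := 1 / (4 * t)) (by positivity)).const_mul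
    ((4 * π * t) ^ (-(d : ℝ) / 2))
  refine this.congr (.of_forall fun x => ?_)
  simp only [heatKernel]
  congr 2
  ring

lemma heatKernel_le (d : ℕ) {t : ℝ} (ht : 0 < t) (x : Rd d) :
    heatKernel d t x ≤ (4 * π * t) ^ (-(d : ℝ) / 2) := by
  unfold heatKernel
  refine mul_le_of_le_one_right (by positivity) (Real.exp_le_one_iff.2 ?_)
  rw [neg_div]
  exact neg_nonpos.2 (by positivity)

lemma norm_sub_sq_div_add_norm_sub_sq_div {d : ℕ} {r τ : ℝ} (hr : 0 < r) (hτ : 0 < τ)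
    (x y z : Rd d) :
    -‖x - y‖ ^ 2 / (4 * r) + -‖y - z‖ ^ 2 / (4 * τ) = -‖x - z‖ ^ 2 / (4 * (r + τ)) +
      -((r + τ) / (4 * r * τ)) *
        ‖y - ((τ / (r + τ)) • x + (r / (r + τ)) • z)‖ ^ 2 := by
  simp only [EuclideanSpace.norm_sq_eq, Real.norm_eq_abs, sq_abs, PiLp.sub_apply, PiLp.add_apply,
    PiLp.smul_apply, smul_eq_mul, ← Finset.sum_neg_distrib, Finset.sum_div, Finset.mul_sum,
    ← Finset.sum_add_distrib]
  refine Finset.sum_congr rfl fun i _ => ?_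
  have : r + τ ≠ 0 := by positivity
  field_simp
  ring

/-- The semigroup property of the heat kernel. -/
lemma integral_heatKernel_mul_heatKernel (d : ℕ) {r τ : ℝ} (hr : 0 < r) (hτ : 0 < τ)
    (x z : Rd d) :
    ∫ y, heatKernel d r (x - y) * heatKernel d τ (y - z) = heatKernel d (r + τ) (x - z) := by
  set m : Rd d := (τ / (r + τ)) • x + (r / (r + τ)) • z with hm
  have hb : 0 < (r + τ) / (4 * r * τ) := by positivity
  have h1 : ∀ y : Rd d, heatKernel d r (x - y) * heatKernel d τ (y - z) =
      ((4 * π * r) ^ (-(d : ℝ) / 2) * (4 * π * τ) ^ (-(d : ℝ) / 2) *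
        Real.exp (-‖x - z‖ ^ 2 / (4 * (r + τ)))) *
        Real.exp (-((r + τ) / (4 * r * τ)) * ‖y - m‖ ^ 2) := fun y => by
    unfold heatKernel
    rw [mul_mul_mul_comm, ← Real.exp_add, norm_sub_sq_div_add_norm_sub_sq_div hr hτ x y z,
      Real.exp_add, ← mul_assoc]
  simp_rw [h1]
  rw [integral_const_mul,
    integral_sub_right_eq_self (fun y : Rd d => Real.exp (-((r + τ) / (4 * r * τ)) * ‖y‖ ^ 2)) m,
    integral_exp_neg_mul_norm_sq d hb, heatKernel]
  have h2 : (4 * π * r) ^ (-(d : ℝ) / 2) * (4 * π * τ) ^ (-(d : ℝ) / 2) *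
      (π / ((r + τ) / (4 * r * τ))) ^ ((d : ℝ) / 2) = (4 * π * (r + τ)) ^ (-(d : ℝ) / 2) := by
    rw [neg_div, Real.rpow_neg (by positivity), Real.rpow_neg (by positivity),
      Real.rpow_neg (by positivity), ← Real.inv_rpow (by positivity),
      ← Real.inv_rpow (by positivity), ← Real.inv_rpow (by positivity),
      ← Real.mul_rpow (by positivity) (by positivity),
      ← Real.mul_rpow (by positivity) (by positivity)]
    congr 1
    field_simp
  rw [← h2]
  ring

lemma le_heatKernel_of_mem_unitCube {d : ℕ} {τ : ℝ} (hτ : 1 / 12 ≤ τ) (hτ1 : τ ≤ 1) {y z : Rd d}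
    (hy : y ∈ unitCube d) (hz : z ∈ unitCube d) :
    (4 * π) ^ (-(d : ℝ) / 2) * Real.exp (-3 * d) ≤ heatKernel d τ (y - z) := by
  unfold heatKernel
  have hτ0 : 0 < τ := by linarith
  have hd : (0 : ℝ) ≤ d := d.cast_nonneg
  gcongr ?_ * Real.exp ?_
  · apply Real.rpow_le_rpow_of_nonpos (by positivity)
    · exact mul_le_of_le_one_right (by positivity) hτ1
    · linarith
  · rw [le_div_iff₀ (by positivity)]
    nlinarith [norm_sub_sq_le_of_mem_unitCube hy hz]

lemma mul_setIntegral_heatKernel_le {d : ℕ} {r τ : ℝ} (hr : 0 < r) (hτ : 1 / 12 ≤ τ)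
    (hτ1 : τ ≤ 1) (x : Rd d) :
    ((4 * π) ^ (-(d : ℝ) / 2) * Real.exp (-3 * d) * volume.real (unitCube d)) * cubeHeat d r x ≤
      cubeHeat d (r + τ) x := by
  have hτ0 : 0 < τ := by linarith
  set c := (4 * π) ^ (-(d : ℝ) / 2) * Real.exp (-3 * d) with hc
  have : IsFiniteMeasure (volume.restrict (unitCube d)) :=
    ⟨by simpa using volume_unitCube_lt_top d⟩
  have hQ := (isClosed_unitCube d).measurableSet
  have hx : Integrable fun y : Rd d => heatKernel d r (x - y) :=
    (integrable_heatKernel d hr).comp_sub_left x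
  have hint : Integrable (fun q : Rd d × Rd d => heatKernel d r (x - q.1) *
      heatKernel d τ (q.1 - q.2)) (volume.prod (volume.restrict (unitCube d))) := by
    refine (hx.mul_prod (integrable_const ((4 * π * τ) ^ (-(d : ℝ) / 2)))).mono' ?_ ?_
    · refine Continuous.aestronglyMeasurable ?_
      have h1 := continuous_heatKernel d r
      have h2 := continuous_heatKernel d τ
      fun_prop
    · refine .of_forall fun q => ?_
      have h1 := heatKernel_nonneg d hr.le (x - q.1)
      rw [Real.norm_of_nonneg (mul_nonneg h1 (heatKernel_nonneg d hτ0.le _))]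
      exact mul_le_mul_of_nonneg_left (heatKernel_le d hτ0 _) h1
  have hswap : cubeHeat d (r + τ) x =
      ∫ y, heatKernel d r (x - y) * ∫ z in unitCube d, heatKernel d τ (y - z) := by
    unfold cubeHeat
    simp_rw [← integral_heatKernel_mul_heatKernel d hr hτ0, ← integral_const_mul]
    exact (integral_integral_swap hint).symm
  have hint' : Integrable fun y : Rd d =>
      heatKernel d r (x - y) * ∫ z in unitCube d, heatKernel d τ (y - z) := by
    simpa only [integral_const_mul] using hint.integral_prod_left
  rw [hswap, cubeHeat, ← integral_const_mul]
  have hnn : ∀ y : Rd d,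
      0 ≤ heatKernel d r (x - y) * ∫ z in unitCube d, heatKernel d τ (y - z) := fun y =>
    mul_nonneg (heatKernel_nonneg d hr.le _)
      (integral_nonneg fun z => heatKernel_nonneg d hτ0.le _)
  refine le_trans ?_ (setIntegral_le_integral (s := unitCube d) hint' (.of_forall hnn))
  refine setIntegral_mono_on (hx.integrableOn.const_mul _) hint'.integrableOn hQ fun y hy => ?_
  rw [mul_comm]
  refine mul_le_mul_of_nonneg_left ?_ (heatKernel_nonneg d hr.le _)
  have hconst : c * volume.real (unitCube d) = ∫ _z in unitCube d, c := by
    simp [mul_comm]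
  rw [hconst]
  exact setIntegral_mono_on (integrable_const _)
    ((integrable_heatKernel d hτ0).comp_sub_left y).integrableOn hQ
    fun z hz => le_heatKernel_of_mem_unitCube hτ hτ1 hy hz

lemma heatKernel_sub_le {d : ℕ} {T : ℝ} (hT : 1 / 12 ≤ T) (hT1 : T ≤ 11 / 12) {x z : Rd d}
    (hz : z ∈ unitCube d) :
    heatKernel d T (x - z) ≤
      (4 * π * (1 / 12)) ^ (-(d : ℝ) / 2) * Real.exp d * Real.exp (-‖x‖ ^ 2 / 8) := by
  unfold heatKernel
  have hT0 : 0 < T := by linarith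
  have hd : (0 : ℝ) ≤ d := d.cast_nonneg
  rw [mul_assoc _ (Real.exp d), ← Real.exp_add]
  gcongr ?_ * Real.exp ?_
  · apply Real.rpow_le_rpow_of_nonpos (by positivity)
    · gcongr
    · linarith
  · have h1 := norm_sq_le_of_mem_unitCube hz
    have h2 : ‖x‖ ^ 2 / 2 - ‖z‖ ^ 2 ≤ ‖x - z‖ ^ 2 := by
      have h3 : ‖x‖ ≤ ‖x - z‖ + ‖z‖ := by simpa using norm_add_le (x - z) z
      nlinarith [sq_nonneg (‖x - z‖ - ‖z‖), norm_nonneg x]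
    have h4 : ‖x - z‖ ^ 2 * (3 / 11) ≤ ‖x - z‖ ^ 2 / (4 * T) := by
      rw [le_div_iff₀ (by positivity)]
      nlinarith [sq_nonneg ‖x - z‖]
    rw [neg_div]
    linarith [sq_nonneg ‖x‖]

lemma cubeHeat_le {d : ℕ} {T : ℝ} (hT : 1 / 12 ≤ T) (hT1 : T ≤ 11 / 12) (x : Rd d) :
    cubeHeat d T x ≤ ((4 * π * (1 / 12)) ^ (-(d : ℝ) / 2) * Real.exp d *
      volume.real (unitCube d)) * Real.exp (-‖x‖ ^ 2 / 8) := by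
  have : IsFiniteMeasure (volume.restrict (unitCube d)) :=
    ⟨by simpa using volume_unitCube_lt_top d⟩
  calc cubeHeat d T x
      ≤ ∫ _z in unitCube d,
        (4 * π * (1 / 12)) ^ (-(d : ℝ) / 2) * Real.exp d * Real.exp (-‖x‖ ^ 2 / 8) :=
        setIntegral_mono_on
          ((integrable_heatKernel d (by linarith)).comp_sub_left x).integrableOn
          (integrable_const _) (isClosed_unitCube d).measurableSet
          fun z hz => heatKernel_sub_le hT hT1 hz
    _ = _ := by
        rw [setIntegral_const, smul_eq_mul]
        ring

lemma abs_integral_heatKernel_mul_le {d : ℕ} {r CF : ℝ} (hr : 0 < r) {f : Rd d → ℝ}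
    (hf : ∀ y, |f y| ≤ CF) (hsupp : Function.support f ⊆ unitCube d) (x : Rd d) :
    |∫ y, heatKernel d r (x - y) * f y| ≤ CF * cubeHeat d r x := by
  have hQ := (isClosed_unitCube d).measurableSet
  have hx : Integrable fun y : Rd d => heatKernel d r (x - y) :=
    (integrable_heatKernel d hr).comp_sub_left x
  rw [cubeHeat, ← integral_const_mul, ← integral_indicator hQ, ← Real.norm_eq_abs]
  refine norm_integral_le_of_norm_le ((hx.const_mul CF).indicator hQ) (.of_forall fun y => ?_)
  by_cases hy : y ∈ unitCube d
  · have h := heatKernel_nonneg d hr.le (x - y)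
    rw [indicator_of_mem hy, norm_mul, Real.norm_of_nonneg h, mul_comm]
    exact mul_le_mul_of_nonneg_right (hf y) h
  · rw [indicator_of_notMem hy, Function.notMem_support.1 fun h => hy (hsupp h)]
    simp

/-- For `d ≥ 2` there is `C = C(d)` such that: whenever
`F : [0,1] × ℝ^d → ℝ` is measurable, bounded by `CF`, vanishes for `s ∈ [0,1/6]`, and
`supp F(s,·) ⊆ Q` for all `s ∈ [0,1]`, then for every `t ∈ (1/6, 1]` and every `x`,
the Duhamel integral `u` satisfies `|u(t,x)| ≤ C·CF·∫_Q p(t-1/12, x-z) dz` and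
`|u(t,x)| ≤ C·CF·exp(-|x|²/8)`. -/
theorem stmt_12 (d : ℕ) (hd : 2 ≤ d) :
    ∃ C : ℝ, 0 < C ∧
      ∀ (F : ℝ → Rd d → ℝ) (CF : ℝ),
        Measurable (Function.uncurry F) →
        (∀ s ∈ Icc (0:ℝ) 1, ∀ x, |F s x| ≤ CF) →
        (∀ s ∈ Icc (0:ℝ) (1/6 : ℝ), ∀ x, F s x = 0) →
        (∀ s ∈ Icc (0:ℝ) 1, Function.support (F s) ⊆ unitCube d) →
        ∀ t ∈ Ioc (1/6 : ℝ) 1, ∀ x : Rd d,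
          |duhamel d F t x| ≤ C * CF * cubeHeat d (t - 1/12) x ∧
          |duhamel d F t x| ≤ C * CF * Real.exp (-‖x‖ ^ 2 / 8) := by
  set c := (4 * π) ^ (-(d : ℝ) / 2) * Real.exp (-3 * d) * volume.real (unitCube d) with hc
  set K := (4 * π * (1 / 12)) ^ (-(d : ℝ) / 2) * Real.exp d * volume.real (unitCube d) with hK
  have hv := volume_real_unitCube_pos d
  have hc0 : 0 < c := by positivity
  have hK0 : 0 < K := by positivity
  refine ⟨c⁻¹ * max 1 K, by positivity, fun F CF _ hF hF0 hsupp t ht x => ?_⟩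
  have hCF : 0 ≤ CF := (abs_nonneg _).trans (hF 0 (by simp) 0)
  have hcube : 0 ≤ cubeHeat d (t - 1 / 12) x :=
    integral_nonneg fun z => heatKernel_nonneg d (by linarith [ht.1]) _
  have hslice : ∀ s ∈ Ioc (0 : ℝ) t, ‖∫ y, heatKernel d (t - s) (x - y) * F s y‖ ≤
      c⁻¹ * CF * cubeHeat d (t - 1 / 12) x := fun s hs => by
    have hs1 : s ∈ Icc (0 : ℝ) 1 := ⟨hs.1.le, hs.2.trans ht.2⟩
    have hB : 0 ≤ c⁻¹ * CF * cubeHeat d (t - 1 / 12) x := by positivity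
    rcases le_or_gt s (1 / 6) with h6 | h6
    · simpa [hF0 s ⟨hs.1.le, h6⟩] using hB
    rcases hs.2.eq_or_lt with rfl | hst
    · simpa [heatKernel_zero (show d ≠ 0 by omega)] using hB
    have h1 := abs_integral_heatKernel_mul_le (sub_pos.2 hst) (hF s hs1) (hsupp s hs1) x
    have h2 := mul_setIntegral_heatKernel_le (d := d) (sub_pos.2 hst)
      (show 1 / 12 ≤ s - 1 / 12 by linarith) (by linarith [hs1.2]) x
    rw [show t - s + (s - 1 / 12) = t - 1 / 12 by ring, ← hc, ← le_inv_mul_iff₀ hc0] at h2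
    calc _ ≤ CF * cubeHeat d (t - s) x := h1
      _ ≤ CF * (c⁻¹ * cubeHeat d (t - 1 / 12) x) := by gcongr
      _ = _ := by ring
  have hmain : |duhamel d F t x| ≤ c⁻¹ * CF * cubeHeat d (t - 1 / 12) x := by
    have ht0 : 0 ≤ t := by linarith [ht.1]
    have h := norm_setIntegral_le_of_norm_le_const (μ := volume) (by simp) hslice
    rw [Real.volume_real_Ioc_of_le ht0, sub_zero] at h
    exact h.trans (mul_le_of_le_one_right (by positivity) ht.2)
  constructor
  · calc _ ≤ c⁻¹ * CF * cubeHeat d (t - 1 / 12) x := hmain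
      _ = c⁻¹ * 1 * CF * cubeHeat d (t - 1 / 12) x := by ring
      _ ≤ _ := by gcongr; exact le_max_left _ _
  · calc _ ≤ c⁻¹ * CF * cubeHeat d (t - 1 / 12) x := hmain
      _ ≤ c⁻¹ * CF * (K * Real.exp (-‖x‖ ^ 2 / 8)) := by
        gcongr
        exact cubeHeat_le (by linarith [ht.1]) (by linarith [ht.2]) x
      _ = c⁻¹ * K * CF * Real.exp (-‖x‖ ^ 2 / 8) := by ring
      _ ≤ _ := by gcongr; exact le_max_right _ _

end
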